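/- Let b ≥ 2 be an integer, let p, q, ϑ > 0 be reals, and for an integer L ≥ 2 set M := ∑_{k=1}^{L−1} b^{⌈(L−k)pϑ⌉} · b^{⌈kqϑ⌉}. Then there exists a constant C depending only on b, p, q, ϑ such that for every integer L ≥ 2, b^{−Lϑ} ≤ C · L^{δ/p} · M^{−min(1/p, 1/q)}, where δ = 1 if p = q and δ = 0 otherwise. Moreover M ≥ b^{(L−1)pϑ}, so that L ≤ C' log M for a constant C' depending only on b, p, ϑ. -/

import Mathlib

open scoped BigOperators

lemma aux_geom (r : ℝ) (h0 : 0 ≤ r) (h1 : r < 1) (s : Finset ℕ) (f : ℕ → ℕ)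
    (hf : ∀ x ∈ s, ∀ y ∈ s, f x = f y → x = y) :
    ∑ k ∈ s, r ^ f k ≤ (1 - r)⁻¹ := by
  rw [← Finset.sum_image (f := fun n => r ^ n) (g := f) hf, ← tsum_geometric_of_lt_one h0 h1]
  exact (summable_geometric_of_lt_one h0 h1).sum_le_tsum _ (fun i _ => pow_nonneg h0 i)

lemma aux_ceil (B x : ℝ) (hB : 1 < B) : B ^ ⌈x⌉ ≤ B * B ^ x := by
  have h0 : 0 < B := by linarith
  rw [← Real.rpow_intCast, mul_comm, ← Real.rpow_add_one h0.ne']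
  exact Real.rpow_le_rpow_of_exponent_le hB.le (Int.ceil_lt_add_one x).le

lemma aux_ceil_ge (B x : ℝ) (hB : 1 < B) : B ^ x ≤ B ^ ⌈x⌉ := by
  rw [← Real.rpow_intCast]
  exact Real.rpow_le_rpow_of_exponent_le hB.le (Int.le_ceil x)

lemma aux_term (B x y : ℝ) (hB : 1 < B) : B ^ ⌈x⌉ * B ^ ⌈y⌉ ≤ B ^ 2 * B ^ (x + y) := by
  have h0 : 0 < B := by linarith
  calc B ^ ⌈x⌉ * B ^ ⌈y⌉ ≤ (B * B ^ x) * (B * B ^ y) :=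
        mul_le_mul (aux_ceil B x hB) (aux_ceil B y hB) (by positivity) (by positivity)
    _ = _ := by rw [Real.rpow_add h0]; ring

/-- upper bound in the unbalanced case -/
lemma aux_unb (B d E : ℝ) (hB : 1 < B) (hd : 0 < d) (s : Finset ℕ) (f : ℕ → ℕ)
    (hf : ∀ x ∈ s, ∀ y ∈ s, f x = f y → x = y) (x y : ℕ → ℝ)
    (hxy : ∀ k ∈ s, x k + y k = E + (-d) * (f k : ℝ)) :
    ∑ k ∈ s, B ^ ⌈x k⌉ * B ^ ⌈y k⌉ ≤ (B ^ 2 * (1 - B ^ (-d))⁻¹) * B ^ E := by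
  have h0 : 0 < B := by linarith
  calc ∑ k ∈ s, B ^ ⌈x k⌉ * B ^ ⌈y k⌉ ≤ ∑ k ∈ s, (B ^ 2 * B ^ E) * (B ^ (-d)) ^ f k := by
        refine Finset.sum_le_sum fun k hk => (aux_term B _ _ hB).trans (le_of_eq ?_)
        rw [hxy k hk, Real.rpow_add h0, Real.rpow_mul h0.le, Real.rpow_natCast]; ring
    _ ≤ (B ^ 2 * B ^ E) * (1 - B ^ (-d))⁻¹ := by
        rw [← Finset.mul_sum]
        exact mul_le_mul_of_nonneg_left (aux_geom _ (by positivity)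
          (Real.rpow_lt_one_of_one_lt_of_neg hB (by linarith)) s f hf) (by positivity)
    _ = _ := by ring

lemma aux_upper (B p q ϑ : ℝ) (hB : 1 < B) (hϑ : 0 < ϑ) :
    ∃ K : ℝ, 0 < K ∧ ∀ L : ℕ, 2 ≤ L →
      ∑ k ∈ Finset.Icc 1 (L - 1),
        B ^ ⌈((L : ℝ) - (k : ℝ)) * p * ϑ⌉ * B ^ ⌈(k : ℝ) * q * ϑ⌉ ≤
      K * (L : ℝ) ^ (if p = q then (1 : ℝ) else 0) * B ^ ((L : ℝ) * ϑ * max p q) := by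
  have h0 : 0 < B := by linarith
  rcases lt_trichotomy p q with h | h | h
  · have hd : 0 < (q - p) * ϑ := mul_pos (by linarith) hϑ
    have h1 := Real.rpow_lt_one_of_one_lt_of_neg hB (neg_lt_zero.2 hd)
    refine ⟨B ^ 2 * (1 - B ^ (-((q - p) * ϑ)))⁻¹,
      mul_pos (by positivity) (inv_pos.2 (by linarith)), fun L hL => ?_⟩
    rw [if_neg h.ne, Real.rpow_zero, mul_one, max_eq_right h.le]
    refine aux_unb B _ _ hB hd _ (fun k => L - k) ?_ _ _ ?_
    · intro x hx y hy hxy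
      simp only [Finset.mem_Icc] at hx hy hxy
      omega
    · intro k hk
      simp only [Finset.mem_Icc] at hk
      rw [Nat.cast_sub (by omega)]
      ring
  · refine ⟨B ^ 2, by positivity, fun L hL => ?_⟩
    subst h
    rw [if_pos rfl, Real.rpow_one, max_self]
    calc _ ≤ ∑ k ∈ Finset.Icc 1 (L - 1), B ^ 2 * B ^ ((L : ℝ) * ϑ * p) := by
          refine Finset.sum_le_sum fun k hk => (aux_term B _ _ hB).trans (le_of_eq ?_)
          congr 2; ring
      _ = ((L - 1 : ℕ) : ℝ) * (B ^ 2 * B ^ ((L : ℝ) * ϑ * p)) := by simp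
      _ ≤ (L : ℝ) * (B ^ 2 * B ^ ((L : ℝ) * ϑ * p)) := by
          refine mul_le_mul_of_nonneg_right ?_ (by positivity)
          exact_mod_cast Nat.sub_le L 1
      _ = _ := by ring
  · have hd : 0 < (p - q) * ϑ := mul_pos (by linarith) hϑ
    have h1 := Real.rpow_lt_one_of_one_lt_of_neg hB (neg_lt_zero.2 hd)
    refine ⟨B ^ 2 * (1 - B ^ (-((p - q) * ϑ)))⁻¹,
      mul_pos (by positivity) (inv_pos.2 (by linarith)), fun L hL => ?_⟩
    rw [if_neg h.ne', Real.rpow_zero, mul_one, max_eq_left h.le]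
    refine aux_unb B _ _ hB hd _ (fun k => k) (fun x _ y _ h => h) _ _ ?_
    intro k hk
    ring

lemma aux_lower (B p q ϑ : ℝ) (hB : 1 < B) (hq : 0 < q) (hϑ : 0 < ϑ) (L : ℕ) (hL : 2 ≤ L) :
    B ^ (((L : ℝ) - 1) * p * ϑ) ≤ ∑ k ∈ Finset.Icc 1 (L - 1),
        B ^ ⌈((L : ℝ) - (k : ℝ)) * p * ϑ⌉ * B ^ ⌈(k : ℝ) * q * ϑ⌉ := by
  have h0 : 0 < B := by linarith
  have h1 : (1 : ℕ) ∈ Finset.Icc 1 (L - 1) := by simp only [Finset.mem_Icc]; omega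
  refine le_trans ?_ (Finset.single_le_sum (f := fun k : ℕ =>
    B ^ ⌈((L : ℝ) - (k : ℝ)) * p * ϑ⌉ * B ^ ⌈(k : ℝ) * q * ϑ⌉)
    (fun k _ => by positivity) h1)
  simp only [Nat.cast_one]
  have h2 : 1 ≤ B ^ ⌈1 * q * ϑ⌉ :=
    (Real.one_le_rpow hB.le (by positivity)).trans (aux_ceil_ge B (1 * q * ϑ) hB)
  calc _ ≤ B ^ ⌈((L : ℝ) - 1) * p * ϑ⌉ := aux_ceil_ge _ _ hB
    _ ≤ _ := le_mul_of_one_le_right (by positivity) h2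

/-- The error-versus-cost computation in the proof of the second part of
Theorem 6.2: with `M(L) = ∑_{k=1}^{L-1} b^{⌈(L-k)pϑ⌉} b^{⌈kqϑ⌉}` one has
`b^{-Lϑ} ≤ C L^{δ/p} M^{-min(1/p,1/q)}` (with `δ = 1` iff `p = q`),
`M ≥ b^{(L-1)pϑ}`, and `L ≤ C' log M`. -/
theorem sparse_grid_error_vs_cost
    (b : ℕ) (hb : 2 ≤ b) (p q ϑ : ℝ) (hp : 0 < p) (hq : 0 < q) (hϑ : 0 < ϑ) :
    (∃ C : ℝ, ∀ L : ℕ, 2 ≤ L →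
      (b : ℝ) ^ (-(L : ℝ) * ϑ) ≤
        C * (L : ℝ) ^ ((if p = q then (1 : ℝ) else 0) / p) *
          (∑ k ∈ Finset.Icc 1 (L - 1),
              (b : ℝ) ^ ⌈((L : ℝ) - (k : ℝ)) * p * ϑ⌉ * (b : ℝ) ^ ⌈(k : ℝ) * q * ϑ⌉) ^
            (-min (1 / p) (1 / q))) ∧
    (∀ L : ℕ, 2 ≤ L →
      (b : ℝ) ^ (((L : ℝ) - 1) * p * ϑ) ≤
        ∑ k ∈ Finset.Icc 1 (L - 1),
          (b : ℝ) ^ ⌈((L : ℝ) - (k : ℝ)) * p * ϑ⌉ * (b : ℝ) ^ ⌈(k : ℝ) * q * ϑ⌉) ∧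
    (∃ C' : ℝ, ∀ L : ℕ, 2 ≤ L →
      (L : ℝ) ≤ C' * Real.log (∑ k ∈ Finset.Icc 1 (L - 1),
          (b : ℝ) ^ ⌈((L : ℝ) - (k : ℝ)) * p * ϑ⌉ * (b : ℝ) ^ ⌈(k : ℝ) * q * ϑ⌉)) := by
  have hB : (1 : ℝ) < b := by exact_mod_cast hb
  have h0 : (0 : ℝ) < b := by linarith
  refine ⟨?_, fun L hL => aux_lower b p q ϑ hB hq hϑ L hL, ?_⟩
  · obtain ⟨K, hK, hM⟩ := aux_upper b p q ϑ hB hϑ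
    refine ⟨K ^ min (1 / p) (1 / q), fun L hL => ?_⟩
    have hM := hM L hL
    have hpos := (Real.rpow_pos_of_pos h0 _).trans_le (aux_lower b p q ϑ hB hq hϑ L hL)
    generalize (∑ k ∈ Finset.Icc 1 (L - 1),
      (b : ℝ) ^ ⌈((L : ℝ) - (k : ℝ)) * p * ϑ⌉ * (b : ℝ) ^ ⌈(k : ℝ) * q * ϑ⌉) = M at hM hpos ⊢
    have hLpos : (0 : ℝ) < L := by exact_mod_cast (by omega : 0 < L)
    have hmin : 0 < min (1 / p) (1 / q) := lt_min (by positivity) (by positivity)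
    have hmm : max p q * min (1 / p) (1 / q) = 1 := by
      rcases le_total p q with h | h
      · rw [max_eq_right h, min_eq_right (one_div_le_one_div_of_le hp h)]
        field_simp
      · rw [max_eq_left h, min_eq_left (one_div_le_one_div_of_le hq h)]
        field_simp
    have hδ : (if p = q then (1 : ℝ) else 0) * min (1 / p) (1 / q)
        = (if p = q then (1 : ℝ) else 0) / p := by
      split_ifs with h
      · subst h; simp
      · simp
    have key := Real.rpow_le_rpow hpos.le hM hmin.le
    rw [Real.mul_rpow (by positivity) (by positivity), Real.mul_rpow (by positivity)
      (by positivity), ← Real.rpow_mul hLpos.le, ← Real.rpow_mul h0.le, mul_assoc _ (max p q),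
      hmm, mul_one, hδ] at key
    have hMp : 0 < M ^ min (1 / p) (1 / q) := Real.rpow_pos_of_pos hpos _
    rw [neg_mul, Real.rpow_neg h0.le, Real.rpow_neg hpos.le, ← div_eq_mul_inv, le_div_iff₀ hMp,
      inv_mul_le_iff₀ (by positivity)]
    linarith
  · have hlog : 0 < Real.log b := Real.log_pos hB
    refine ⟨2 / (p * ϑ * Real.log b), fun L hL => ?_⟩
    have hl := Real.log_le_log (Real.rpow_pos_of_pos h0 _) (aux_lower b p q ϑ hB hq hϑ L hL)
    rw [Real.log_rpow h0] at hl
    rw [div_mul_eq_mul_div, le_div_iff₀ (by positivity)]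
    have hL' : (2 : ℝ) ≤ L := by exact_mod_cast hL
    have hc : 0 < p * ϑ * Real.log b := by positivity
    nlinarith
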